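/- Let n ≥ 3, d = d_n, a_i = d_{n,i} for 0 ≤ i ≤ n, a_{n+1} = 1, and let ℓ be an integer with 1 ≤ ℓ ≤ d − 1. Define θ_i(ℓ) as the fractional part of ℓ/s_i for 0 ≤ i ≤ n and θ_{n+1}(ℓ) = ℓ/d, and set T_0(ℓ) = { i ∈ {0,…,n} : s_i divides ℓ } and T_1(ℓ) = {0,…,n+1} \ T_0(ℓ). Then there do not exist integers (k_i)_{i ∈ T_0(ℓ)} with 0 ≤ k_i ≤ s_i − 2 for all i ∈ T_0(ℓ) such that ∑_{i ∈ T_1(ℓ)} (d/2 − a_i) + ∑_{i ∈ T_0(ℓ)} k_i a_i = d and ∑_{i ∈ T_1(ℓ)} (θ_i(ℓ) − 1/2) = 0. -/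

import Mathlib

/-- The Sylvester sequence: `s 0 = 2`, `s (n+1) = 1 + s 0 * s 1 * ⋯ * s n`. -/
def syl : ℕ → ℕ
  | 0 => 2
  | n + 1 => 1 + ∏ k ∈ (Finset.range (n + 1)).attach, syl k.1
decreasing_by exact Finset.mem_range.mp k.2

/-- `d n = ∏_{k=0}^{n} s k`. -/
def dS (n : ℕ) : ℕ := ∏ k ∈ Finset.range (n + 1), syl k

/-- `d⟨n,j⟩ = d n / s j`. -/
def dSj (n j : ℕ) : ℕ := dS n / syl j

theorem syl_zero : syl 0 = 2 := by rw [syl]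

theorem syl_succ (n : ℕ) : syl (n + 1) = 1 + dS n := by
  rw [syl, dS, Finset.prod_attach (Finset.range (n + 1)) syl]

theorem dS_succ (n : ℕ) : dS (n + 1) = dS n * syl (n + 1) := by
  rw [dS, Finset.prod_range_succ, ← dS]

theorem syl_pos (n : ℕ) : 0 < syl n := by
  cases n with
  | zero => simp [syl_zero]
  | succ n => rw [syl_succ]; omega

theorem dS_pos (n : ℕ) : 0 < dS n := Finset.prod_pos fun _ _ => syl_pos _

theorem two_le_syl (n : ℕ) : 2 ≤ syl n := by
  cases n with
  | zero => simp [syl_zero]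
  | succ n => rw [syl_succ]; have := dS_pos n; omega

theorem dSj_eq_prod_erase {n j : ℕ} (hj : j ≤ n) :
    dSj n j = ∏ k ∈ (Finset.range (n + 1)).erase j, syl k := by
  rw [dSj, dS, ← Finset.mul_prod_erase _ _ (Finset.mem_range.2 (Nat.lt_succ_of_le hj)),
    Nat.mul_div_cancel_left _ (syl_pos j)]

theorem syl_mul_dSj {n j : ℕ} (hj : j ≤ n) : syl j * dSj n j = dS n := by
  rw [dSj_eq_prod_erase hj, dS,
    Finset.mul_prod_erase _ _ (Finset.mem_range.2 (Nat.lt_succ_of_le hj))]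

theorem syl_dvd_dSj {n i j : ℕ} (hi : i ≤ n) (hj : j ≤ n) (hij : i ≠ j) :
    syl i ∣ dSj n j := by
  rw [dSj_eq_prod_erase hj]
  exact Finset.dvd_prod_of_mem _
    (Finset.mem_erase.2 ⟨hij, Finset.mem_range.2 (Nat.lt_succ_of_le hi)⟩)

theorem dSj_succ {n j : ℕ} (hj : j ≤ n) : dSj (n + 1) j = dSj n j * syl (n + 1) := by
  apply Nat.eq_of_mul_eq_mul_left (syl_pos j)
  rw [syl_mul_dSj (hj.trans n.le_succ), ← mul_assoc, syl_mul_dSj hj, dS_succ]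

theorem dSj_succ_self (n : ℕ) : dSj (n + 1) (n + 1) = dS n := by
  apply Nat.eq_of_mul_eq_mul_left (syl_pos (n + 1))
  rw [syl_mul_dSj le_rfl, dS_succ, mul_comm]

theorem sum_dSj_add_one (n : ℕ) : ∑ i ∈ Finset.range (n + 1), dSj n i + 1 = dS n := by
  induction n with
  | zero => simp [dSj, dS, syl_zero]
  | succ n ih =>
    rw [Finset.sum_range_succ, dSj_succ_self,
      Finset.sum_congr rfl fun i hi => dSj_succ (Nat.lt_succ_iff.1 (Finset.mem_range.1 hi)),
      ← Finset.sum_mul, dS_succ, ← ih, syl_succ, ← ih]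
    ring

theorem syl_dvd_dSj_self_add_one {n i : ℕ} (hi : i ≤ n) : syl i ∣ dSj n i + 1 := by
  have hmem : i ∈ Finset.range (n + 1) := Finset.mem_range.2 (Nat.lt_succ_of_le hi)
  have hsum := sum_dSj_add_one n
  rw [← Finset.sum_erase_add _ _ hmem, add_assoc] at hsum
  refine (Nat.dvd_add_right (Finset.dvd_sum fun j hj => ?_)).1
    (hsum ▸ Dvd.intro _ (syl_mul_dSj hi))
  obtain ⟨hji, hj⟩ := Finset.mem_erase.1 hj
  exact syl_dvd_dSj hi (Nat.lt_succ_iff.1 (Finset.mem_range.1 hj)) hji.symm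

/-- The degree equation, after adding the contributions of `T` to those of its complement. -/
theorem sum_mul_dSj_of_degree_eq {n : ℕ} {T : Finset ℕ} (hT : T ⊆ Finset.range (n + 1))
    {k : ℕ → ℕ}
    (h : (∑ i ∈ Finset.range (n + 2) \ T,
          ((dS n : ℚ) / 2 - (if i ≤ n then (dSj n i : ℚ) else 1))) +
        (∑ i ∈ T, (k i : ℚ) * (dSj n i : ℚ)) = (dS n : ℚ)) :
    ∑ i ∈ T, ((k i : ℤ) + 1) * dSj n i = ((T.card : ℤ) + 2 - n) * dSj n 0 := by
  have hsub : T ⊆ Finset.range (n + 2) :=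
    hT.trans (Finset.range_subset_range.2 (Nat.le_succ _))
  have hle : ∀ i ∈ Finset.range (n + 1), (if i ≤ n then (dSj n i : ℚ) else 1) = dSj n i :=
    fun i hi => if_pos (Nat.lt_succ_iff.1 (Finset.mem_range.1 hi))
  have hsplit := Finset.sum_sdiff (f := fun i => (dS n : ℚ) / 2 -
    (if i ≤ n then (dSj n i : ℚ) else 1)) hsub
  have htotal : ∑ i ∈ Finset.range (n + 2), (if i ≤ n then (dSj n i : ℚ) else 1) = dS n := by
    rw [Finset.sum_range_succ, Finset.sum_congr rfl hle, if_neg (by omega)]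
    exact_mod_cast sum_dSj_add_one n
  have hd : (dS n : ℚ) = 2 * dSj n 0 := by
    have := syl_mul_dSj (Nat.zero_le n)
    rw [syl_zero] at this
    exact_mod_cast this.symm
  simp only [Finset.sum_sub_distrib, Finset.sum_const, nsmul_eq_mul, Finset.card_range,
    htotal, Finset.sum_congr rfl fun i hi => hle i (hT hi)] at hsplit h
  have key : ∑ i ∈ T, ((k i : ℚ) + 1) * dSj n i = ((T.card : ℚ) + 2 - n) * dSj n 0 := by
    simp only [add_mul, one_mul, Finset.sum_add_distrib]
    push_cast at hsplit
    rw [hd] at hsplit h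
    linear_combination h - hsplit
  exact_mod_cast key

theorem syl_dvd_add_one_of_sum_eq {n i : ℕ} {T : Finset ℕ} (hT : T ⊆ Finset.range (n + 1))
    {k : ℕ → ℕ} {c : ℤ} (h : ∑ i ∈ T, ((k i : ℤ) + 1) * dSj n i = c * dSj n 0)
    (hi : i ∈ T) (hi0 : i ≠ 0) : syl i ∣ k i + 1 := by
  have hle : ∀ {j}, j ∈ T → j ≤ n := fun hj => Nat.lt_succ_iff.1 (Finset.mem_range.1 (hT hj))
  have hself : (syl i : ℤ) ∣ (dSj n i : ℤ) + 1 := by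
    exact_mod_cast syl_dvd_dSj_self_add_one (hle hi)
  have hright : (syl i : ℤ) ∣ c * dSj n 0 :=
    (Int.natCast_dvd_natCast.2 (syl_dvd_dSj (hle hi) (Nat.zero_le n) hi0)).mul_left _
  rw [← h, ← Finset.sum_erase_add _ _ hi] at hright
  have hmul := (dvd_add_right (Finset.dvd_sum fun j hj => ?_)).1 hright
  · have := dvd_sub (hself.mul_left ((k i : ℤ) + 1)) hmul
    rw [mul_add, mul_one, add_sub_cancel_left] at this
    exact_mod_cast this
  · obtain ⟨hji, hj⟩ := Finset.mem_erase.1 hj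
    exact (Int.natCast_dvd_natCast.2 (syl_dvd_dSj (hle hi) (hle hj) hji.symm)).mul_left _

/-- For `n ≥ 3` and `1 ≤ ℓ ≤ d − 1`, with `θ_i(ℓ) = {ℓ/s_i}` for `i ≤ n`,
`θ_{n+1}(ℓ) = ℓ/d`, `T_0(ℓ) = {i ≤ n : s_i ∣ ℓ}` and `T_1(ℓ) = {0,…,n+1} \ T_0(ℓ)`:
there are no integers `0 ≤ k_i ≤ s_i − 2` (`i ∈ T_0(ℓ)`) with
`∑_{i ∈ T_1} (d/2 − a_i) + ∑_{i ∈ T_0} k_i a_i = d` and `∑_{i ∈ T_1} (θ_i − 1/2) = 0`;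
i.e. `N(ℓ) = 0` for all `ℓ > 0`. -/
theorem count_N_ell_eq_zero (n : ℕ) (hn : 3 ≤ n) (ℓ : ℕ)
    (hℓ1 : 1 ≤ ℓ) (hℓ2 : ℓ ≤ dS n - 1) :
    ¬ ∃ k : ℕ → ℕ,
      (∀ i ∈ (Finset.range (n + 1)).filter (fun i => syl i ∣ ℓ), k i ≤ syl i - 2) ∧
      ((∑ i ∈ Finset.range (n + 2) \
            (Finset.range (n + 1)).filter (fun i => syl i ∣ ℓ),
          ((dS n : ℚ) / 2 - (if i ≤ n then (dSj n i : ℚ) else 1))) +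
        (∑ i ∈ (Finset.range (n + 1)).filter (fun i => syl i ∣ ℓ),
          (k i : ℚ) * (dSj n i : ℚ)) = (dS n : ℚ)) ∧
      (∑ i ∈ Finset.range (n + 2) \
            (Finset.range (n + 1)).filter (fun i => syl i ∣ ℓ),
          ((if i ≤ n then Int.fract ((ℓ : ℚ) / (syl i : ℚ)) else (ℓ : ℚ) / (dS n : ℚ))
            - 1 / 2)) = 0 := by
  rintro ⟨k, hk, hdeg, -⟩
  set T := (Finset.range (n + 1)).filter (fun i => syl i ∣ ℓ)
  have hT : T ⊆ Finset.range (n + 1) := Finset.filter_subset _ _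
  have hsum := sum_mul_dSj_of_degree_eq hT hdeg
  have hT0 : T ⊆ {0} := fun i hi => by
    by_contra hi0
    have := Nat.le_of_dvd (Nat.succ_pos _)
      (syl_dvd_add_one_of_sum_eq hT hsum hi (by simpa using hi0))
    have := hk i hi
    have := two_le_syl i
    omega
  have hpos : (0 : ℤ) < dSj n 0 := by
    have := syl_mul_dSj (Nat.zero_le n) ▸ dS_pos n
    exact_mod_cast Nat.pos_of_mul_pos_left this
  have hn' : (3 : ℤ) ≤ n := by exact_mod_cast hn
  obtain hT | hT := Finset.subset_singleton_iff.1 hT0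
  · rw [hT, Finset.sum_empty, Finset.card_empty] at hsum
    push_cast at hsum
    nlinarith
  · rw [hT, Finset.sum_singleton, Finset.card_singleton] at hsum
    push_cast at hsum
    nlinarith [mul_nonneg (Int.natCast_nonneg (k 0)) hpos.le]
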